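/- Fix A ∈ ℝ^{m×n}, a target rank r, and sketch size parameters k, ℓ with r + 1 < k ≤ min(m,n), ℓ ≤ m, and ℓ > k + 1. Let Ω ∈ ℝ^{n×k} and Ψ ∈ ℝ^{ℓ×m} be independent real standard normal random matrices. Let Q = Q(Ω) ∈ ℝ^{m×k} be a measurable function of Ω such that Q has orthonormal columns (QᵀQ = I_k) and the column space of Q contains the column space of AΩ; define (almost surely) X := ((ΨQ)ᵀ(ΨQ))⁻¹(ΨQ)ᵀ Ψ A, and let B = B(Ω, Ψ) be a measurable choice of matrix with rank(B) ≤ r minimizing ‖QX − ·‖_F over matrices of rank at most r. Then for every natural number ϱ with ϱ < k − 1, E ‖A − B‖_F ≤ τ_{r+1}(A) + 2 · sqrt(1 + k/(ℓ − k − 1)) · sqrt(1 + ϱ/(k − ϱ − 1)) · τ_{ϱ+1}(A). (Corollary 6.3, fixed-rank approximation Frobenius-norm error, real case.) -/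

import Mathlib

open Matrix MeasureTheory ProbabilityTheory

/-- Frobenius norm of a real matrix. -/
noncomputable def frobNorm {m n : ℕ} (M : Matrix (Fin m) (Fin n) ℝ) : ℝ :=
  Real.sqrt (∑ i, ∑ j, ‖M i j‖ ^ 2)

/-- `j`-th tail energy: `τ_j(A) = sqrt (inf {‖A - B‖_F² : rank B < j})`. -/
noncomputable def tailEnergy {m n : ℕ} (A : Matrix (Fin m) (Fin n) ℝ) (j : ℕ) : ℝ :=
  Real.sqrt (sInf {x : ℝ | ∃ B : Matrix (Fin m) (Fin n) ℝ,
    B.rank < j ∧ x = frobNorm (A - B) ^ 2})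

instance matrixMeasurableSpace {t s : ℕ} : MeasurableSpace (Matrix (Fin t) (Fin s) ℝ) :=
  MeasurableSpace.pi

/-- The law of a `t × s` real standard normal matrix: the entries are independent
standard Gaussians. -/
noncomputable def gaussMatrix (t s : ℕ) : Measure (Matrix (Fin t) (Fin s) ℝ) :=
  Measure.pi fun _ : Fin t => Measure.pi fun _ : Fin s => gaussianReal 0 1

lemma pi_gaussianReal_eq_withDensity (ι : Type*) [Fintype ι] :
    Measure.pi (fun _ : ι => gaussianReal 0 1) =
      (volume : Measure (ι → ℝ)).withDensity
        (fun x => ENNReal.ofReal (∏ i, gaussianPDFReal 0 1 (x i))) := by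
  refine (Measure.pi_eq fun s hs => ?_)
  have hint : ∀ i, Integrable ((s i).indicator (gaussianPDFReal 0 1)) volume := fun i =>
    (integrable_gaussianPDFReal 0 1).indicator (hs i)
  have hbox : (Set.univ.pi s).indicator
      (fun x : ι → ℝ => ENNReal.ofReal (∏ i, gaussianPDFReal 0 1 (x i)))
      = fun x => ENNReal.ofReal (∏ i, (s i).indicator (gaussianPDFReal 0 1) (x i)) := by
    ext x
    by_cases hx : x ∈ Set.univ.pi s
    · rw [Set.indicator_of_mem hx]
      congr 1
      refine Finset.prod_congr rfl fun i _ => ?_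
      rw [Set.indicator_of_mem (hx i (Set.mem_univ i))]
    · rw [Set.indicator_of_notMem hx]
      simp only [Set.mem_univ_pi, not_forall] at hx
      obtain ⟨i, hi⟩ := hx
      rw [Finset.prod_eq_zero (Finset.mem_univ i) (Set.indicator_of_notMem hi _)]
      simp
  rw [withDensity_apply _ (MeasurableSet.univ_pi hs),
    ← lintegral_indicator (MeasurableSet.univ_pi hs), hbox,
    ← ofReal_integral_eq_lintegral_ofReal (μ := volume) (Integrable.fintype_prod hint)
      (Filter.Eventually.of_forall fun x => Finset.prod_nonneg fun i _ =>
        Set.indicator_nonneg (fun _ _ => gaussianPDFReal_nonneg _ _ _) _),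
    integral_fintype_prod_volume_eq_prod (fun i x => (s i).indicator (gaussianPDFReal 0 1) x),
    ENNReal.ofReal_prod_of_nonneg fun i _ => integral_nonneg
      (Set.indicator_nonneg fun _ _ => gaussianPDFReal_nonneg _ _ _)]
  refine Finset.prod_congr rfl fun i _ => ?_
  rw [integral_indicator (hs i), gaussianReal_apply_eq_integral _ one_ne_zero]

lemma hasDerivAt_gaussianPDFReal_line (x v : ℝ) :
    HasDerivAt (fun t : ℝ => gaussianPDFReal 0 1 (x + t * v))
      (-(x * v) * gaussianPDFReal 0 1 x) 0 := by
  simp only [gaussianPDFReal, sub_zero, NNReal.coe_one, mul_one]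
  have h : HasDerivAt (fun t : ℝ => -(x + t * v) ^ 2 / 2) (-(x * v)) 0 := by
    have h1 : HasDerivAt (fun t : ℝ => x + t * v) v 0 := by
      simpa using ((hasDerivAt_id (0 : ℝ)).mul_const v).const_add x
    convert! ((h1.pow 2).neg.div_const 2) using 1
    simp; ring
  convert! (h.exp.const_mul _) using 1
  simp; ring

lemma hasLineDerivAt_prod_gaussianPDFReal {ι : Type*} [Fintype ι] (x v : ι → ℝ) :
    HasLineDerivAt ℝ (fun x : ι → ℝ => ∏ i, gaussianPDFReal 0 1 (x i))
      (-(∑ i, x i * v i) * ∏ i, gaussianPDFReal 0 1 (x i)) x v := by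
  classical
  have h := HasDerivAt.fun_finsetProd (u := Finset.univ) (x := (0 : ℝ))
    (fun i _ => hasDerivAt_gaussianPDFReal_line (x i) (v i))
  refine (h.congr_deriv ?_)
  rw [neg_mul, Finset.sum_mul, ← Finset.sum_neg_distrib]
  refine Finset.sum_congr rfl fun i _ => ?_
  rw [← Finset.mul_prod_erase _ _ (Finset.mem_univ i)]
  simp
  ring

/-- **Gaussian integration by parts** for the standard Gaussian measure on `ι → ℝ`. -/
lemma integral_mul_inner_pi_gaussianReal {ι : Type*} [Fintype ι] {f f' : (ι → ℝ) → ℝ}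
    (v : ι → ℝ) (hf : ∀ x, HasLineDerivAt ℝ f (f' x) x v)
    (hfi : Integrable f (Measure.pi fun _ : ι => gaussianReal 0 1))
    (hfx : Integrable (fun x => f x * ∑ i, x i * v i) (Measure.pi fun _ : ι => gaussianReal 0 1))
    (hf' : Integrable f' (Measure.pi fun _ : ι => gaussianReal 0 1)) :
    ∫ x, f x * ∑ i, x i * v i ∂(Measure.pi fun _ : ι => gaussianReal 0 1)
      = ∫ x, f' x ∂(Measure.pi fun _ : ι => gaussianReal 0 1) := by
  have hmeas : Measurable fun x : ι → ℝ => ENNReal.ofReal (∏ i, gaussianPDFReal 0 1 (x i)) := by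
    refine ENNReal.measurable_ofReal.comp (Finset.measurable_prod _ fun i _ => ?_)
    exact (measurable_gaussianPDFReal 0 1).comp (measurable_pi_apply i)
  have htop : ∀ᵐ x : ι → ℝ, ENNReal.ofReal (∏ i, gaussianPDFReal 0 1 (x i)) < ⊤ :=
    Filter.Eventually.of_forall fun _ => ENNReal.ofReal_lt_top
  have hreal : ∀ x : ι → ℝ, (ENNReal.ofReal (∏ i, gaussianPDFReal 0 1 (x i))).toReal
      = ∏ i, gaussianPDFReal 0 1 (x i) := fun x =>
    ENNReal.toReal_ofReal (Finset.prod_nonneg fun i _ => gaussianPDFReal_nonneg _ _ _)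
  rw [pi_gaussianReal_eq_withDensity] at hfi hfx hf' ⊢
  rw [integrable_withDensity_iff_integrable_smul' hmeas htop] at hfi hfx hf'
  simp only [integral_withDensity_eq_integral_toReal_smul hmeas htop, hreal, smul_eq_mul] at *
  have key := integral_bilinear_hasLineDerivAt_right_eq_neg_left_of_integrable
    (μ := (volume : Measure (ι → ℝ))) (f := f) (f' := f')
    (g := fun x : ι → ℝ => ∏ i, gaussianPDFReal 0 1 (x i))
    (g' := fun x => -(∑ i, x i * v i) * ∏ i, gaussianPDFReal 0 1 (x i)) (v := v)
    (B := ContinuousLinearMap.mul ℝ ℝ)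
    (hf'.congr (Filter.Eventually.of_forall fun x => by simp [mul_comm]))
    (hfx.neg.congr (Filter.Eventually.of_forall fun x => by simp; ring))
    (hfi.congr (Filter.Eventually.of_forall fun x => by simp [mul_comm]))
    (fun x _ => hf x) (fun x _ => hasLineDerivAt_prod_gaussianPDFReal x v)
  simp only [ContinuousLinearMap.mul_apply'] at key
  rw [← neg_inj, ← integral_neg]
  refine (integral_congr_ae (.of_forall fun x => ?_)).trans
    (key.trans (congrArg Neg.neg (integral_congr_ae (.of_forall fun x => ?_))))
  · ring
  · ring

instance {t s : ℕ} : BorelSpace (Matrix (Fin t) (Fin s) ℝ) :=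
  inferInstanceAs (BorelSpace (Fin t → Fin s → ℝ))

instance {t s : ℕ} : IsProbabilityMeasure (gaussMatrix t s) :=
  inferInstanceAs (IsProbabilityMeasure
    (Measure.pi fun _ : Fin t => Measure.pi fun _ : Fin s => gaussianReal 0 1))

lemma gaussMatrix_box {t s : ℕ} (u : Fin t → Fin s → Set ℝ) :
    gaussMatrix t s {M | ∀ i j, M i j ∈ u i j} = ∏ i, ∏ j, gaussianReal 0 1 (u i j) := by
  have h : {M : Fin t → Fin s → ℝ | ∀ i j, M i j ∈ u i j}
      = Set.univ.pi fun i => Set.univ.pi fun j => u i j := by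
    ext M; simp [Set.mem_pi]
  change (Measure.pi fun _ : Fin t => Measure.pi fun _ : Fin s => gaussianReal 0 1)
    {M : Fin t → Fin s → ℝ | ∀ i j, M i j ∈ u i j} = _
  rw [h, Measure.pi_pi]
  simp_rw [Measure.pi_pi]

lemma map_uncurry_gaussMatrix (t s : ℕ) :
    (gaussMatrix t s).map (fun M (p : Fin t × Fin s) => M p.1 p.2)
      = Measure.pi fun _ => gaussianReal 0 1 := by
  refine (Measure.pi_eq fun u hu => ?_).symm
  have hm : Measurable fun (M : Matrix (Fin t) (Fin s) ℝ) (p : Fin t × Fin s) => M p.1 p.2 :=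
    measurable_pi_lambda _ fun p => (measurable_pi_apply p.2).comp (measurable_pi_apply p.1)
  rw [Measure.map_apply hm (MeasurableSet.univ_pi hu)]
  have : (fun (M : Matrix (Fin t) (Fin s) ℝ) (p : Fin t × Fin s) => M p.1 p.2) ⁻¹'
      Set.univ.pi u = {M | ∀ i j, M i j ∈ u (i, j)} := by
    ext M; simp [Set.mem_pi]
  rw [this, gaussMatrix_box fun i j => u (i, j), Fintype.prod_prod_type]

lemma measurable_transpose_matrix {t s : ℕ} :
    Measurable (transpose : Matrix (Fin t) (Fin s) ℝ → Matrix (Fin s) (Fin t) ℝ) :=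
  (Continuous.matrix_transpose continuous_id).measurable

lemma map_transpose_gaussMatrix (t s : ℕ) :
    (gaussMatrix t s).map transpose = gaussMatrix s t := by
  have hm : Measurable fun (M : Matrix (Fin t) (Fin s) ℝ) (p : Fin s × Fin t) => M p.2 p.1 :=
    measurable_pi_lambda _ fun p => (measurable_pi_apply p.1).comp (measurable_pi_apply p.2)
  have hm' : Measurable fun (M : Matrix (Fin s) (Fin t) ℝ) (p : Fin s × Fin t) => M p.1 p.2 :=
    measurable_pi_lambda _ fun p => (measurable_pi_apply p.2).comp (measurable_pi_apply p.1)
  have hback : Measurable fun (x : Fin s × Fin t → ℝ) => (of fun i j => x (i, j) :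
      Matrix (Fin s) (Fin t) ℝ) :=
    measurable_pi_lambda _ fun i => measurable_pi_lambda _ fun j => measurable_pi_apply _
  have hflat : (gaussMatrix t s).map (fun M (p : Fin s × Fin t) => M p.2 p.1)
      = Measure.pi fun _ => gaussianReal 0 1 := by
    refine (Measure.pi_eq fun u hu => ?_).symm
    rw [Measure.map_apply hm (MeasurableSet.univ_pi hu)]
    have : (fun (M : Matrix (Fin t) (Fin s) ℝ) (p : Fin s × Fin t) => M p.2 p.1) ⁻¹'
        Set.univ.pi u = {M | ∀ i j, M i j ∈ u (j, i)} := by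
      ext M; simp only [Set.mem_preimage, Set.mem_univ_pi, Prod.forall]; exact forall_comm
    rw [this, gaussMatrix_box fun i j => u (j, i), Fintype.prod_prod_type_right]
  have h := congrArg (Measure.map fun (x : Fin s × Fin t → ℝ) => (of fun i j => x (i, j) :
      Matrix (Fin s) (Fin t) ℝ)) (hflat.trans (map_uncurry_gaussMatrix s t).symm)
  rw [Measure.map_map hback hm, Measure.map_map hback hm'] at h
  exact h.trans Measure.map_id

lemma measurePreserving_entry_gaussMatrix {t s : ℕ} (i : Fin t) (j : Fin s) :
    MeasurePreserving (fun M : Matrix (Fin t) (Fin s) ℝ => M i j) (gaussMatrix t s)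
      (gaussianReal 0 1) :=
  (measurePreserving_eval (fun _ : Fin s => gaussianReal 0 1) j).comp
    (measurePreserving_eval (fun _ : Fin t => Measure.pi fun _ : Fin s => gaussianReal 0 1) i)

lemma memLp_entry_gaussMatrix {t s : ℕ} (i : Fin t) (j : Fin s) :
    MemLp (fun M : Matrix (Fin t) (Fin s) ℝ => M i j) 2 (gaussMatrix t s) :=
  (memLp_id_gaussianReal' 2 (by simp)).comp_measurePreserving
    (measurePreserving_entry_gaussMatrix i j)

lemma memLp_mul_entry_gaussMatrix {t s p : ℕ} (C : Matrix (Fin s) (Fin p) ℝ) (i : Fin t)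
    (j : Fin p) :
    MemLp (fun M : Matrix (Fin t) (Fin s) ℝ => (M * C) i j) 2 (gaussMatrix t s) := by
  simp only [mul_apply]
  exact memLp_finsetSum _ fun x _ => (memLp_entry_gaussMatrix i x).mul_const _

/-- **Gaussian integration by parts** in the direction of a matrix with a single nonzero row. -/
lemma integral_mul_entry_gaussMatrix {t s p : ℕ} (C : Matrix (Fin s) (Fin p) ℝ) (i : Fin t)
    (j : Fin p) {f f' : Matrix (Fin t) (Fin s) ℝ → ℝ}
    (hf : ∀ M, HasDerivAt (fun u : ℝ => f (M + u • vecMulVec (Pi.single i 1) (C.col j))) (f' M) 0)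
    (hfi : MemLp f 2 (gaussMatrix t s)) (hf' : Integrable f' (gaussMatrix t s)) :
    ∫ M, f M * (M * C) i j ∂gaussMatrix t s = ∫ M, f' M ∂gaussMatrix t s := by
  let e : Matrix (Fin t) (Fin s) ℝ ≃ᵐ (Fin t × Fin s → ℝ) :=
    { toFun := fun M p => M p.1 p.2
      invFun := fun x => of fun i j => x (i, j)
      left_inv := fun _ => rfl
      right_inv := fun _ => rfl
      measurable_toFun :=
        measurable_pi_lambda _ fun p => (measurable_pi_apply p.2).comp (measurable_pi_apply p.1)
      measurable_invFun := measurable_pi_lambda _ fun i => measurable_pi_lambda _ fun j =>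
        measurable_pi_apply _ }
  have he : MeasurePreserving e (gaussMatrix t s) (Measure.pi fun _ => gaussianReal 0 1) :=
    ⟨e.measurable, map_uncurry_gaussMatrix t s⟩
  have he_apply : ∀ M p, e M p = M p.1 p.2 := fun _ _ => rfl
  have hinner : ∀ M : Matrix (Fin t) (Fin s) ℝ,
      ∑ p, e M p * e (vecMulVec (Pi.single i 1) (C.col j)) p = (M * C) i j := by
    intro M
    rw [Fintype.sum_prod_type, Finset.sum_eq_single i]
    · simp [he_apply, mul_apply, vecMulVec_apply]
    · intro b _ hb
      simp [he_apply, vecMulVec_apply, hb]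
    · simp
  have hcomp : ∀ g : Matrix (Fin t) (Fin s) ℝ → ℝ,
      Integrable (fun x => g (e.symm x)) (Measure.pi fun _ => gaussianReal 0 1) ↔
        Integrable g (gaussMatrix t s) := fun g =>
    (he.symm e).integrable_comp_emb e.symm.measurableEmbedding
  have key := integral_mul_inner_pi_gaussianReal (f := fun x => f (e.symm x))
    (f' := fun x => f' (e.symm x)) (e (vecMulVec (Pi.single i 1) (C.col j)))
    (fun x => hf (e.symm x)) ((hcomp _).2 (hfi.integrable (by norm_num)))
    (((hcomp _).2 (hfi.integrable_mul (memLp_mul_entry_gaussMatrix C i j))).congr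
      (.of_forall fun x => by simp [← hinner])) ((hcomp _).2 hf')
  rw [← he.integral_comp e.measurableEmbedding, ← he.integral_comp e.measurableEmbedding] at key
  simpa [hinner] using key

lemma mul_single_mul_apply {a b c d : ℕ} (P : Matrix (Fin a) (Fin b) ℝ)
    (R : Matrix (Fin c) (Fin d) ℝ) (i : Fin a) (j : Fin b) (x : Fin c) (y : Fin d) :
    (P * single j x (1 : ℝ) * R) i y = P i j * R x y := by
  rw [mul_apply, Finset.sum_eq_single x]
  · simp
  · intro z _ hz
    rw [mul_single_apply_of_ne _ _ _ _ _ hz, zero_mul]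
  · simp

/-- The regularised inverse Gram matrix `(GᵀG + ε)⁻¹`. -/
noncomputable def regGramInv {ℓ k : ℕ} (ε : ℝ) (G : Matrix (Fin ℓ) (Fin k) ℝ) :
    Matrix (Fin k) (Fin k) ℝ :=
  (Gᵀ * G + ε • (1 : Matrix (Fin k) (Fin k) ℝ))⁻¹

section RegGramInv

variable {ℓ k : ℕ} {ε : ℝ}

lemma isUnit_det_gram_add (hε : 0 < ε) (G : Matrix (Fin ℓ) (Fin k) ℝ) :
    IsUnit (Gᵀ * G + ε • (1 : Matrix (Fin k) (Fin k) ℝ)).det := by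
  have h1 : (Gᵀ * G).PosSemidef := by
    simpa [conjTranspose_eq_transpose_of_trivial] using posSemidef_conjTranspose_mul_self G
  have h2 : (ε • (1 : Matrix (Fin k) (Fin k) ℝ)).PosDef := PosDef.one.smul hε
  exact (PosDef.posSemidef_add h1 h2).det_pos.ne'.isUnit

lemma regGramInv_mul_gram (hε : 0 < ε) (G : Matrix (Fin ℓ) (Fin k) ℝ) :
    regGramInv ε G * (Gᵀ * G) = 1 - ε • regGramInv ε G := by
  have h := nonsing_inv_mul _ (isUnit_det_gram_add hε G)
  rw [Matrix.mul_add, Matrix.mul_smul, Matrix.mul_one] at h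
  exact eq_sub_of_add_eq h

lemma transpose_regGramInv (G : Matrix (Fin ℓ) (Fin k) ℝ) :
    (regGramInv ε G)ᵀ = regGramInv ε G := by
  simp [regGramInv, transpose_nonsing_inv]

lemma trace_transpose_mul_self_eq_sum {a b : ℕ} (M : Matrix (Fin a) (Fin b) ℝ) :
    (Mᵀ * M).trace = ∑ i, ∑ j, M i j ^ 2 := by
  simp only [trace, diag_apply, mul_apply, transpose_apply]
  rw [Finset.sum_comm]
  simp_rw [sq]

lemma trace_transpose_mul_self_nonneg {a b : ℕ} (M : Matrix (Fin a) (Fin b) ℝ) :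
    0 ≤ (Mᵀ * M).trace := by
  rw [trace_transpose_mul_self_eq_sum]; positivity

lemma sq_entry_le_trace {a b : ℕ} (M : Matrix (Fin a) (Fin b) ℝ) (i : Fin a) (j : Fin b) :
    M i j ^ 2 ≤ (Mᵀ * M).trace := by
  rw [trace_transpose_mul_self_eq_sum]
  exact (Finset.single_le_sum (f := fun j => M i j ^ 2) (fun _ _ => sq_nonneg _)
    (Finset.mem_univ j)).trans (Finset.single_le_sum (f := fun i => ∑ j, M i j ^ 2)
    (fun _ _ => Finset.sum_nonneg fun _ _ => sq_nonneg _) (Finset.mem_univ i))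

lemma trace_regGramInv (hε : 0 < ε) (G : Matrix (Fin ℓ) (Fin k) ℝ) :
    (regGramInv ε G).trace = ((G * regGramInv ε G)ᵀ * (G * regGramInv ε G)).trace
      + ε * ((regGramInv ε G)ᵀ * regGramInv ε G).trace := by
  have h : regGramInv ε G * (Gᵀ * G) * regGramInv ε G + ε • (regGramInv ε G * regGramInv ε G)
      = regGramInv ε G := by
    rw [regGramInv_mul_gram hε, sub_mul, one_mul, Matrix.smul_mul, sub_add_cancel]
  rw [transpose_mul, transpose_regGramInv, ← smul_eq_mul, ← trace_smul, ← trace_add]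
  conv_lhs => rw [← h]
  simp only [Matrix.mul_assoc]

lemma trace_regGramInv_nonneg (hε : 0 < ε) (G : Matrix (Fin ℓ) (Fin k) ℝ) :
    0 ≤ (regGramInv ε G).trace := by
  rw [trace_regGramInv hε]
  have := trace_transpose_mul_self_nonneg (G * regGramInv ε G)
  have := trace_transpose_mul_self_nonneg (regGramInv ε G)
  positivity

lemma trace_mul_regGramInv_mul_transpose (hε : 0 < ε) (G : Matrix (Fin ℓ) (Fin k) ℝ) :
    (G * regGramInv ε G * Gᵀ).trace = k - ε * (regGramInv ε G).trace := by
  rw [Matrix.mul_assoc, trace_mul_comm, Matrix.mul_assoc, regGramInv_mul_gram hε]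
  simp [trace_sub, trace_smul]

lemma trace_transpose_mul_regGramInv_le (hε : 0 < ε) (G : Matrix (Fin ℓ) (Fin k) ℝ) :
    ((G * regGramInv ε G)ᵀ * (G * regGramInv ε G)).trace ≤ (regGramInv ε G).trace := by
  rw [trace_regGramInv hε]
  have := trace_transpose_mul_self_nonneg (regGramInv ε G)
  nlinarith

lemma trace_regGramInv_le (hε : 0 < ε) (G : Matrix (Fin ℓ) (Fin k) ℝ) :
    (regGramInv ε G).trace ≤ k / ε := by
  have h : 0 ≤ (G * regGramInv ε G * Gᵀ).trace := by
    have h1 := trace_mul_comm (G * regGramInv ε G) Gᵀ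
    have h2 : (Gᵀ * (G * regGramInv ε G)).trace = (((G * regGramInv ε G)ᵀ * G)).trace := by
      rw [← trace_transpose]; simp
    have h3 : (G * regGramInv ε G)ᵀ * G = (G * regGramInv ε G)ᵀ * (G * regGramInv ε G)
        * (Gᵀ * G) + ε • ((G * regGramInv ε G)ᵀ * (G * regGramInv ε G)) := by
      have := regGramInv_mul_gram hε G
      rw [Matrix.mul_assoc, Matrix.mul_assoc G, this, Matrix.mul_sub, Matrix.mul_one,
        Matrix.mul_sub]
      simp
    have h4 : (Gᵀ * (G * regGramInv ε G)).trace = ((G * regGramInv ε G * Gᵀ)ᵀ *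
        (G * regGramInv ε G * Gᵀ)).trace + 
        ε * ((G * regGramInv ε G)ᵀ * (G * regGramInv ε G)).trace := by
      rw [h2, h3, trace_add, trace_smul, smul_eq_mul]
      congr 1
      rw [← Matrix.mul_assoc, trace_mul_comm]
      simp [Matrix.mul_assoc]
    rw [h1, h4]
    have := trace_transpose_mul_self_nonneg (G * regGramInv ε G)
    have := trace_transpose_mul_self_nonneg (G * regGramInv ε G * Gᵀ)
    positivity
  rw [trace_mul_regGramInv_mul_transpose hε] at h
  rw [le_div_iff₀ hε]
  linarith

lemma abs_mul_regGramInv_entry_le (hε : 0 < ε) (G : Matrix (Fin ℓ) (Fin k) ℝ) (i : Fin ℓ)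
    (b : Fin k) : |(G * regGramInv ε G) i b| ≤ √(k / ε) :=
  Real.abs_le_sqrt ((sq_entry_le_trace _ i b).trans
    ((trace_transpose_mul_regGramInv_le hε G).trans (trace_regGramInv_le hε G)))

lemma abs_regGramInv_entry_le (hε : 0 < ε) (G : Matrix (Fin ℓ) (Fin k) ℝ) (a b : Fin k) :
    |regGramInv ε G a b| ≤ √(k / ε / ε) := by
  refine Real.abs_le_sqrt ((sq_entry_le_trace _ a b).trans ?_)
  rw [le_div_iff₀ hε]
  refine le_trans ?_ (trace_regGramInv_le hε G)
  rw [trace_regGramInv hε]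
  have := trace_transpose_mul_self_nonneg (G * regGramInv ε G)
  linarith

lemma continuous_regGramInv (hε : 0 < ε) :
    Continuous (regGramInv ε : Matrix (Fin ℓ) (Fin k) ℝ → _) := by
  have hN : Continuous fun G : Matrix (Fin ℓ) (Fin k) ℝ =>
      Gᵀ * G + ε • (1 : Matrix (Fin k) (Fin k) ℝ) := by fun_prop
  unfold regGramInv
  simp only [inv_def, Ring.inverse_eq_inv']
  exact (hN.matrix_det.inv₀ fun G => (isUnit_det_gram_add hε G).ne_zero).smul
    hN.matrix_adjugate

open scoped Matrix.Norms.Operator in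
lemma hasDerivAt_regGramInv_line (hε : 0 < ε) (G D : Matrix (Fin ℓ) (Fin k) ℝ) (a b : Fin k) :
    HasDerivAt (fun t : ℝ => regGramInv ε (G + t • D) a b)
      (-(regGramInv ε G * (Dᵀ * G + Gᵀ * D) * regGramInv ε G) a b) 0 := by
  have hN : HasDerivAt (fun t : ℝ => (Gᵀ * G + ε • (1 : Matrix (Fin k) (Fin k) ℝ))
      + t • (Dᵀ * G + Gᵀ * D) + t ^ 2 • (Dᵀ * D)) (Dᵀ * G + Gᵀ * D) 0 := by
    have h1 := (hasDerivAt_id (0 : ℝ)).smul_const (Dᵀ * G + Gᵀ * D)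
    have h2 := ((hasDerivAt_id (0 : ℝ)).pow 2).smul_const (Dᵀ * D)
    convert! ((h1.const_add (Gᵀ * G + ε • (1 : Matrix (Fin k) (Fin k) ℝ))).add h2) using 1
    simp
  have hN' : (fun t : ℝ => (Gᵀ * G + ε • (1 : Matrix (Fin k) (Fin k) ℝ))
      + t • (Dᵀ * G + Gᵀ * D) + t ^ 2 • (Dᵀ * D)) = fun t : ℝ =>
      (G + t • D)ᵀ * (G + t • D) + ε • (1 : Matrix (Fin k) (Fin k) ℝ) := by
    funext t
    simp only [transpose_add, transpose_smul, Matrix.add_mul, Matrix.mul_add, Matrix.smul_mul,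
      Matrix.mul_smul, smul_add, pow_two, smul_smul]
    abel
  have hu : IsUnit (Gᵀ * G + ε • (1 : Matrix (Fin k) (Fin k) ℝ)) :=
    (isUnit_iff_isUnit_det _).2 (isUnit_det_gram_add hε G)
  have hinv := hasFDerivAt_ringInverse (𝕜 := ℝ) hu.unit
  have h0 : (hu.unit : Matrix (Fin k) (Fin k) ℝ) = (fun t : ℝ =>
      (G + t • D)ᵀ * (G + t • D) + ε • (1 : Matrix (Fin k) (Fin k) ℝ)) 0 := by simp
  rw [hN'] at hN
  rw [h0] at hinv
  have h := hinv.comp_hasDerivAt (0 : ℝ) hN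
  have h' := (hasDerivAt_pi.1 ((hasDerivAt_pi.1 h) a)) b
  convert! h' using 1
  · ext t
    simp [regGramInv, nonsing_inv_eq_ringInverse]
  · simp [regGramInv, coe_units_inv]

lemma hasDerivAt_mul_regGramInv_line (hε : 0 < ε) (G : Matrix (Fin ℓ) (Fin k) ℝ) (i : Fin ℓ)
    (b : Fin k) :
    HasDerivAt (fun t : ℝ => ((G + t • single i b (1 : ℝ)) *
        regGramInv ε (G + t • single i b (1 : ℝ))) i b)
      (regGramInv ε G b b - (G * regGramInv ε G) i b ^ 2
        - (G * regGramInv ε G * Gᵀ) i i * regGramInv ε G b b) 0 := by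
  have hentry : ∀ a : Fin k, HasDerivAt
      (fun t : ℝ => (G + t • single i b (1 : ℝ)) i a) (single i b (1 : ℝ) i a) 0 := by
    intro a
    simpa [-smul_single] using
      ((hasDerivAt_id (0 : ℝ)).mul_const (single i b (1 : ℝ) i a)).const_add (G i a)
  have h := HasDerivAt.fun_sum (u := Finset.univ) fun (a : Fin k) _ =>
    (hentry a).mul (hasDerivAt_regGramInv_line hε G (single i b (1 : ℝ)) a b)
  simp only [mul_apply (M := G + _)]
  refine h.congr_deriv ?_
  have h1 : ∑ a, G i a * (regGramInv ε G * ((single i b (1 : ℝ))ᵀ * G + Gᵀ * single i b (1 : ℝ))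
      * regGramInv ε G) a b = (G * regGramInv ε G * single b i (1 : ℝ) * (G * regGramInv ε G)
      + G * regGramInv ε G * Gᵀ * single i b (1 : ℝ) * regGramInv ε G) i b := by
    rw [← mul_apply]
    simp only [transpose_single, Matrix.mul_add, Matrix.add_mul, Matrix.mul_assoc]
  have h2 : ∑ a, single i b (1 : ℝ) i a * regGramInv ε G a b = regGramInv ε G b b := by
    simp [single_apply]
  simp only [zero_smul, add_zero, Finset.sum_add_distrib, h2, mul_neg, Finset.sum_neg_distrib, h1]
  rw [Matrix.add_apply, mul_single_mul_apply, mul_single_mul_apply]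
  ring

end RegGramInv

section Expectation

variable {ℓ m k p : ℕ} {ε : ℝ}

lemma integrable_of_continuous_of_abs_le {t s : ℕ} {f : Matrix (Fin t) (Fin s) ℝ → ℝ}
    (hf : Continuous f) {K : ℝ} (hK : ∀ M, |f M| ≤ K) : Integrable f (gaussMatrix t s) :=
  Integrable.of_bound hf.aestronglyMeasurable K (.of_forall hK)

lemma memLp_continuous_mul_of_abs_le {t s : ℕ} {f g : Matrix (Fin t) (Fin s) ℝ → ℝ}
    (hf : Continuous f) {K : ℝ} (hK : ∀ M, |f M| ≤ K) (hg : MemLp g 2 (gaussMatrix t s)) :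
    MemLp (fun M => f M * g M) 2 (gaussMatrix t s) :=
  hg.of_le_mul (c := K) (hf.aestronglyMeasurable.mul hg.1) (.of_forall fun M => by
    rw [norm_mul]; exact mul_le_mul_of_nonneg_right (hK M) (norm_nonneg _))

lemma continuous_regGramInv_mul (hε : 0 < ε) (Q : Matrix (Fin m) (Fin k) ℝ) :
    Continuous fun M : Matrix (Fin ℓ) (Fin m) ℝ => regGramInv ε (M * Q) :=
  (continuous_regGramInv hε).comp (by fun_prop)

lemma continuous_mul_regGramInv_entry (hε : 0 < ε) (Q : Matrix (Fin m) (Fin k) ℝ) (i : Fin ℓ)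
    (b : Fin k) :
    Continuous fun M : Matrix (Fin ℓ) (Fin m) ℝ => (M * Q * regGramInv ε (M * Q)) i b :=
  Continuous.matrix_elem (Continuous.matrix_mul (by fun_prop) (continuous_regGramInv_mul hε Q)) i b

lemma memLp_mul_regGramInv_entry (hε : 0 < ε) (Q : Matrix (Fin m) (Fin k) ℝ) (i : Fin ℓ)
    (b : Fin k) :
    MemLp (fun M : Matrix (Fin ℓ) (Fin m) ℝ => (M * Q * regGramInv ε (M * Q)) i b) 2
      (gaussMatrix ℓ m) :=
  MemLp.of_bound (continuous_mul_regGramInv_entry hε Q i b).aestronglyMeasurable _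
    (.of_forall fun M => abs_mul_regGramInv_entry_le hε (M * Q) i b)

lemma integrable_trace_regGramInv (hε : 0 < ε) (Q : Matrix (Fin m) (Fin k) ℝ) :
    Integrable (fun M => (regGramInv ε (M * Q)).trace) (gaussMatrix ℓ m) :=
  integrable_of_continuous_of_abs_le (continuous_regGramInv_mul hε Q).matrix_trace
    (K := k / ε) fun M => by
      rw [abs_of_nonneg (trace_regGramInv_nonneg hε _)]; exact trace_regGramInv_le hε _

lemma vecMulVec_single_col_mul {p q : ℕ} (C : Matrix (Fin m) (Fin p) ℝ)
    (Q : Matrix (Fin m) (Fin q) ℝ) (i : Fin ℓ) (j : Fin p) :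
    vecMulVec (Pi.single i 1) (C.col j) * Q = vecMulVec (Pi.single i 1) ((Cᵀ * Q).row j) := by
  rw [vecMulVec_mul]
  congr 1

/-- Uniform bound for the expected trace of the regularised inverse Gram matrix of a Gaussian
matrix. -/
lemma integral_trace_regGramInv_le (hℓ : k + 1 < ℓ) (hε : 0 < ε) (Q : Matrix (Fin m) (Fin k) ℝ)
    (hQ : Qᵀ * Q = 1) :
    ∫ M, (regGramInv ε (M * Q)).trace ∂gaussMatrix ℓ m ≤ k / ((ℓ : ℝ) - k - 1) := by
  have hpos : (0 : ℝ) < (ℓ : ℝ) - k - 1 := by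
    have : ((k + 1 : ℕ) : ℝ) < ℓ := by exact_mod_cast hℓ
    push_cast at this; linarith
  let f : Fin ℓ → Fin k → Matrix (Fin ℓ) (Fin m) ℝ → ℝ := fun i b M =>
    (M * Q * regGramInv ε (M * Q)) i b
  let f' : Fin ℓ → Fin k → Matrix (Fin ℓ) (Fin m) ℝ → ℝ := fun i b M =>
    regGramInv ε (M * Q) b b - (M * Q * regGramInv ε (M * Q)) i b ^ 2
      - (M * Q * regGramInv ε (M * Q) * (M * Q)ᵀ) i i * regGramInv ε (M * Q) b b
  have hf2 : ∀ i b, MemLp (f i b) 2 (gaussMatrix ℓ m) := memLp_mul_regGramInv_entry hε Q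
  have hS : ∀ b, Continuous fun M : Matrix (Fin ℓ) (Fin m) ℝ => regGramInv ε (M * Q) b b :=
    fun b => (continuous_regGramInv_mul hε Q).matrix_elem b b
  have hf'i : ∀ i b, Integrable (f' i b) (gaussMatrix ℓ m) := by
    intro i b
    refine ((integrable_of_continuous_of_abs_le (hS b)
      fun M => abs_regGramInv_entry_le hε _ b b).sub (hf2 i b).integrable_sq).sub ?_
    have hG : MemLp (fun M : Matrix (Fin ℓ) (Fin m) ℝ =>
        (M * Q * regGramInv ε (M * Q) * (M * Q)ᵀ) i i) 2 (gaussMatrix ℓ m) := by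
      have : (fun M : Matrix (Fin ℓ) (Fin m) ℝ =>
          (M * Q * regGramInv ε (M * Q) * (M * Q)ᵀ) i i)
          = fun M => ∑ a, (M * Q * regGramInv ε (M * Q)) i a * (M * Q) i a := rfl
      rw [this]
      exact memLp_finsetSum _ fun a _ => memLp_continuous_mul_of_abs_le
        (continuous_mul_regGramInv_entry hε Q i a)
        (fun M => abs_mul_regGramInv_entry_le hε (M * Q) i a)
        (memLp_mul_entry_gaussMatrix Q i a)
    exact ((memLp_continuous_mul_of_abs_le (hS b)
      (fun M => abs_regGramInv_entry_le hε _ b b) hG).integrable (by norm_num)).congr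
      (.of_forall fun M => mul_comm _ _)
  have hstein : ∀ i b, ∫ M, f i b M * (M * Q) i b ∂gaussMatrix ℓ m
      = ∫ M, f' i b M ∂gaussMatrix ℓ m := fun i b =>
    integral_mul_entry_gaussMatrix Q i b (fun M => by
      have hdir : vecMulVec (Pi.single i 1) (Q.col b) * Q = single i b (1 : ℝ) := by
        rw [vecMulVec_single_col_mul, hQ, single_eq_single_vecMulVec_single]
        congr 1
        ext j
        simp [one_apply, Pi.single_apply, eq_comm]
      have := hasDerivAt_mul_regGramInv_line hε (M * Q) i b
      simpa only [f, f', Matrix.add_mul, Matrix.smul_mul, hdir] using this) (hf2 i b) (hf'i i b)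
  have hleft : ∀ M, ∑ i, ∑ b, f i b M * (M * Q) i b
      = k - ε * (regGramInv ε (M * Q)).trace := fun M => by
    rw [← trace_mul_regGramInv_mul_transpose hε]
    rfl
  have hright : ∀ M, ((ℓ : ℝ) - k - 1) * (regGramInv ε (M * Q)).trace
      ≤ ∑ i, ∑ b, f' i b M := fun M => by
    have h1 : ∑ i, ∑ b, f' i b M = ℓ * (regGramInv ε (M * Q)).trace
        - ((M * Q * regGramInv ε (M * Q))ᵀ * (M * Q * regGramInv ε (M * Q))).trace
        - (M * Q * regGramInv ε (M * Q) * (M * Q)ᵀ).trace * (regGramInv ε (M * Q)).trace := by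
      rw [trace_transpose_mul_self_eq_sum]
      simp only [f', Finset.sum_sub_distrib, ← Finset.mul_sum, ← Finset.sum_mul, trace, diag_apply]
      simp
    rw [h1, trace_mul_regGramInv_mul_transpose hε]
    nlinarith [trace_transpose_mul_regGramInv_le hε (M * Q), trace_regGramInv_nonneg hε (M * Q),
      mul_nonneg hε.le (mul_self_nonneg (regGramInv ε (M * Q)).trace)]
  have hprod : ∀ i b, Integrable (fun M => f i b M * (M * Q) i b) (gaussMatrix ℓ m) :=
    fun i b => (hf2 i b).integrable_mul (memLp_mul_entry_gaussMatrix Q i b)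
  have hsum : ∫ M, ∑ i, ∑ b, f i b M * (M * Q) i b ∂gaussMatrix ℓ m
      = ∫ M, ∑ i, ∑ b, f' i b M ∂gaussMatrix ℓ m := by
    rw [integral_finsetSum _ fun i _ => integrable_finsetSum _ fun b _ => hprod i b,
      integral_finsetSum _ fun i _ => integrable_finsetSum _ fun b _ => hf'i i b]
    refine Finset.sum_congr rfl fun i _ => ?_
    rw [integral_finsetSum _ fun b _ => hprod i b,
      integral_finsetSum _ fun b _ => hf'i i b]
    exact Finset.sum_congr rfl fun b _ => hstein i b
  have hT := integrable_trace_regGramInv (ℓ := ℓ) hε Q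
  rw [le_div_iff₀ hpos, mul_comm, ← integral_const_mul]
  calc _ ≤ ∫ M, ∑ i, ∑ b, f' i b M ∂gaussMatrix ℓ m :=
        integral_mono (hT.const_mul _)
          (integrable_finsetSum _ fun i _ => integrable_finsetSum _ fun b _ => hf'i i b) hright
    _ = ∫ M, ((k : ℝ) - ε * (regGramInv ε (M * Q)).trace) ∂gaussMatrix ℓ m := by
        rw [← hsum]; simp_rw [hleft]
    _ ≤ ∫ M, (k : ℝ) ∂gaussMatrix ℓ m :=
        integral_mono ((integrable_const _).sub (hT.const_mul _)) (integrable_const _) fun M =>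
          sub_le_self _ (mul_nonneg hε.le (trace_regGramInv_nonneg hε _))
    _ = k := by simp

lemma integral_trace_sq_regGramInv_le (hℓ : k + 1 < ℓ) (hε : 0 < ε)
    (Q : Matrix (Fin m) (Fin k) ℝ) (hQ : Qᵀ * Q = 1) (C : Matrix (Fin m) (Fin p) ℝ)
    (hC : Cᵀ * Q = 0) :
    Integrable (fun M => (((M * Q * regGramInv ε (M * Q))ᵀ * (M * C))ᵀ *
      ((M * Q * regGramInv ε (M * Q))ᵀ * (M * C))).trace) (gaussMatrix ℓ m) ∧
    ∫ M, (((M * Q * regGramInv ε (M * Q))ᵀ * (M * C))ᵀ *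
      ((M * Q * regGramInv ε (M * Q))ᵀ * (M * C))).trace ∂gaussMatrix ℓ m
      ≤ k / ((ℓ : ℝ) - k - 1) * (Cᵀ * C).trace := by
  let g : Fin ℓ → Fin k → Matrix (Fin ℓ) (Fin m) ℝ → ℝ := fun i a M =>
    (M * Q * regGramInv ε (M * Q)) i a
  let H : Fin k → Fin p → Matrix (Fin ℓ) (Fin m) ℝ → ℝ := fun a j M =>
    ((M * Q * regGramInv ε (M * Q))ᵀ * (M * C)) a j
  have hg2 : ∀ i a, MemLp (g i a) 2 (gaussMatrix ℓ m) := memLp_mul_regGramInv_entry hε Q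
  have hHsum : ∀ a j M, H a j M = ∑ i, g i a M * (M * C) i j := fun a j M => rfl
  have hgmul : ∀ i a {h : Matrix (Fin ℓ) (Fin m) ℝ → ℝ}, MemLp h 2 (gaussMatrix ℓ m) →
      MemLp (fun M => g i a M * h M) 2 (gaussMatrix ℓ m) := fun i a {h} hh =>
    memLp_continuous_mul_of_abs_le (continuous_mul_regGramInv_entry hε Q i a)
      (fun M => abs_mul_regGramInv_entry_le hε (M * Q) i a) hh
  have hH2 : ∀ a j, MemLp (H a j) 2 (gaussMatrix ℓ m) := fun a j => by
    have : H a j = fun M => ∑ i, g i a M * (M * C) i j := funext (hHsum a j)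
    rw [this]
    exact memLp_finsetSum _ fun i _ => hgmul i a (memLp_mul_entry_gaussMatrix C i j)
  have hstein : ∀ i a j, ∫ M, g i a M * H a j M * (M * C) i j ∂gaussMatrix ℓ m
      = ∫ M, g i a M ^ 2 * (Cᵀ * C) j j ∂gaussMatrix ℓ m := fun i a j =>
    integral_mul_entry_gaussMatrix C i j (fun M => by
      have hdir : vecMulVec (Pi.single i 1) (C.col j) * Q = (0 : Matrix (Fin ℓ) (Fin k) ℝ) := by
        rw [vecMulVec_single_col_mul, hC]
        ext x y
        simp [vecMulVec_apply]
      have hG : ∀ u : ℝ, (M + u • vecMulVec (Pi.single i 1) (C.col j)) * Q = M * Q := fun u => by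
        rw [Matrix.add_mul, Matrix.smul_mul, hdir, smul_zero, add_zero]
      have hline : ∀ u : ℝ, g i a (M + u • vecMulVec (Pi.single i 1) (C.col j)) *
          H a j (M + u • vecMulVec (Pi.single i 1) (C.col j))
          = g i a M * H a j M + u * (g i a M ^ 2 * (Cᵀ * C) j j) := fun u => by
        have h1 : ((M * Q * regGramInv ε (M * Q))ᵀ * vecMulVec (Pi.single i 1)
            ((Cᵀ * C).row j)) a j = g i a M * (Cᵀ * C) j j := by
          rw [mul_vecMulVec, vecMulVec_apply, mulVec_single_one]
          rfl
        simp only [g, H, hG]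
        rw [Matrix.add_mul, Matrix.smul_mul, vecMulVec_single_col_mul, Matrix.mul_add,
          Matrix.mul_smul, Matrix.add_apply, Matrix.smul_apply, h1]
        simp only [g, smul_eq_mul]
        ring
      simp_rw [hline]
      simpa using ((hasDerivAt_id (0 : ℝ)).mul_const
        (g i a M ^ 2 * (Cᵀ * C) j j)).const_add (g i a M * H a j M))
      (hgmul i a (hH2 a j)) ((hg2 i a).integrable_sq.mul_const _)
  have hHint : ∀ a j, ∫ M, H a j M ^ 2 ∂gaussMatrix ℓ m
      = ∑ i, ∫ M, g i a M ^ 2 * (Cᵀ * C) j j ∂gaussMatrix ℓ m := fun a j => by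
    have hprod : ∀ i, Integrable (fun M => g i a M * H a j M * (M * C) i j)
        (gaussMatrix ℓ m) := fun i =>
      (hgmul i a (hH2 a j)).integrable_mul (memLp_mul_entry_gaussMatrix C i j)
    rw [← Finset.sum_congr rfl fun i _ => hstein i a j,
      ← integral_finsetSum _ fun i _ => hprod i]
    refine integral_congr_ae (.of_forall fun M => ?_)
    calc H a j M ^ 2 = H a j M * ∑ i, g i a M * (M * C) i j := by rw [← hHsum, sq]
      _ = ∑ i, g i a M * H a j M * (M * C) i j := by
        rw [Finset.mul_sum]
        exact Finset.sum_congr rfl fun i _ => by ring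
  simp only [trace_transpose_mul_self_eq_sum]
  refine ⟨integrable_finsetSum _ fun a _ => integrable_finsetSum _ fun j _ =>
    (hH2 a j).integrable_sq, ?_⟩
  calc _ = ∑ a, ∑ j, ∫ M, H a j M ^ 2 ∂gaussMatrix ℓ m := by
        rw [integral_finsetSum _ fun a _ => integrable_finsetSum _ fun j _ =>
          (hH2 a j).integrable_sq]
        exact Finset.sum_congr rfl fun a _ =>
          integral_finsetSum _ fun j _ => (hH2 a j).integrable_sq
    _ = (∫ M, ((M * Q * regGramInv ε (M * Q))ᵀ * (M * Q * regGramInv ε (M * Q))).trace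
          ∂gaussMatrix ℓ m) * (Cᵀ * C).trace := by
        simp only [trace_transpose_mul_self_eq_sum (M := _ * _)]
        rw [integral_finsetSum _ fun i _ => integrable_finsetSum _ fun a _ =>
          (hg2 i a).integrable_sq]
        simp_rw [hHint, integral_mul_const]
        rw [trace, Finset.mul_sum, Finset.sum_comm]
        refine Finset.sum_congr rfl fun j _ => ?_
        rw [Finset.sum_comm, Finset.sum_mul]
        refine Finset.sum_congr rfl fun i _ => ?_
        rw [integral_finsetSum _ fun a _ => (hg2 i a).integrable_sq, Finset.sum_mul]
        rfl
    _ ≤ _ := by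
        rw [← trace_transpose_mul_self_eq_sum]
        refine mul_le_mul_of_nonneg_right (le_trans (integral_mono ?_
          (integrable_trace_regGramInv hε Q) fun M => trace_transpose_mul_regGramInv_le hε _)
          (integral_trace_regGramInv_le hℓ hε Q hQ)) (trace_transpose_mul_self_nonneg C)
        simp only [trace_transpose_mul_self_eq_sum (M := _ * _)]
        exact integrable_finsetSum _ fun i _ => integrable_finsetSum _ fun a _ =>
          (hg2 i a).integrable_sq

end Expectation

lemma frobNorm_nonneg {m n : ℕ} (M : Matrix (Fin m) (Fin n) ℝ) : 0 ≤ frobNorm M :=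
  Real.sqrt_nonneg _

lemma frobNorm_sq {m n : ℕ} (M : Matrix (Fin m) (Fin n) ℝ) :
    frobNorm M ^ 2 = (Mᵀ * M).trace := by
  rw [frobNorm, Real.sq_sqrt (by positivity), trace_transpose_mul_self_eq_sum]
  simp

lemma frobNorm_transpose {m n : ℕ} (M : Matrix (Fin m) (Fin n) ℝ) : frobNorm Mᵀ = frobNorm M := by
  simp only [frobNorm, transpose_apply]
  rw [Finset.sum_comm]

lemma frobNorm_add_le {m n : ℕ} (M N : Matrix (Fin m) (Fin n) ℝ) :
    frobNorm (M + N) ≤ frobNorm M + frobNorm N := by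
  let : SeminormedAddCommGroup (Matrix (Fin m) (Fin n) ℝ) := frobeniusSeminormedAddCommGroup
  have h : ∀ P : Matrix (Fin m) (Fin n) ℝ, frobNorm P = ‖P‖ := fun P => by
    rw [frobenius_norm_def, frobNorm, Real.sqrt_eq_rpow]
    simp
  rw [h, h, h]
  exact norm_add_le M N

lemma frobNorm_sub_comm {m n : ℕ} (M N : Matrix (Fin m) (Fin n) ℝ) :
    frobNorm (M - N) = frobNorm (N - M) := by
  simp only [frobNorm, Matrix.sub_apply, norm_sub_rev]

lemma continuous_frobNorm {m n : ℕ} :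
    Continuous (frobNorm : Matrix (Fin m) (Fin n) ℝ → ℝ) := by
  unfold frobNorm
  fun_prop

lemma frobNorm_sub_mul_sq {m n k : ℕ} {Q : Matrix (Fin m) (Fin k) ℝ} (hQ : Qᵀ * Q = 1)
    {R : Matrix (Fin m) (Fin n) ℝ} (hR : Qᵀ * R = 0) (Z : Matrix (Fin k) (Fin n) ℝ) :
    frobNorm (R - Q * Z) ^ 2 = frobNorm R ^ 2 + frobNorm Z ^ 2 := by
  have hR' : Rᵀ * Q = 0 := by
    rw [← transpose_transpose (Rᵀ * Q), transpose_mul, transpose_transpose, hR, transpose_zero]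
  have h : (R - Q * Z)ᵀ * (R - Q * Z) = Rᵀ * R + Zᵀ * Z := by
    rw [transpose_sub, transpose_mul, Matrix.sub_mul, Matrix.mul_sub, Matrix.mul_sub,
      ← Matrix.mul_assoc Rᵀ, hR', Matrix.mul_assoc Zᵀ, hR, Matrix.mul_assoc Zᵀ,
      ← Matrix.mul_assoc Qᵀ, hQ]
    simp
  simp only [frobNorm_sq, h, trace_add]

lemma transpose_mul_sub_proj {m n k : ℕ} {Q : Matrix (Fin m) (Fin k) ℝ} (hQ : Qᵀ * Q = 1)
    (A : Matrix (Fin m) (Fin n) ℝ) : Qᵀ * (A - Q * (Qᵀ * A)) = 0 := by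
  rw [Matrix.mul_sub, ← Matrix.mul_assoc, hQ, Matrix.one_mul, sub_self]

/-- Orthogonal projection gives the best approximation with a prescribed column space. -/
lemma frobNorm_sub_proj_sq_le {m n k : ℕ} {Q : Matrix (Fin m) (Fin k) ℝ} (hQ : Qᵀ * Q = 1)
    (A : Matrix (Fin m) (Fin n) ℝ) (Z : Matrix (Fin k) (Fin n) ℝ) :
    frobNorm (A - Q * (Qᵀ * A)) ^ 2 ≤ frobNorm (A - Q * Z) ^ 2 := by
  have h : A - Q * Z = A - Q * (Qᵀ * A) - Q * (Z - Qᵀ * A) := by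
    rw [Matrix.mul_sub]; abel
  rw [h, frobNorm_sub_mul_sq hQ (transpose_mul_sub_proj hQ A)]
  exact le_add_of_nonneg_right (sq_nonneg _)

lemma frobNorm_sub_sketch_sq {m n k ℓ : ℕ} {Q : Matrix (Fin m) (Fin k) ℝ} (hQ : Qᵀ * Q = 1)
    (A : Matrix (Fin m) (Fin n) ℝ) (Ψ : Matrix (Fin ℓ) (Fin m) ℝ)
    (hdet : IsUnit ((Ψ * Q)ᵀ * (Ψ * Q)).det) :
    frobNorm (A - Q * (((Ψ * Q)ᵀ * (Ψ * Q))⁻¹ * (Ψ * Q)ᵀ * (Ψ * A))) ^ 2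
      = frobNorm (A - Q * (Qᵀ * A)) ^ 2
        + frobNorm (((Ψ * Q)ᵀ * (Ψ * Q))⁻¹ * (Ψ * Q)ᵀ * (Ψ * (A - Q * (Qᵀ * A)))) ^ 2 := by
  rw [← frobNorm_sub_mul_sq hQ (transpose_mul_sub_proj hQ A)]
  congr 2
  have h : ((Ψ * Q)ᵀ * (Ψ * Q))⁻¹ * (Ψ * Q)ᵀ * (Ψ * (Q * (Qᵀ * A))) = Qᵀ * A := by
    rw [← Matrix.mul_assoc Ψ Q, ← Matrix.mul_assoc, Matrix.mul_assoc _ (Ψ * Q)ᵀ (Ψ * Q),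
      nonsing_inv_mul _ hdet, Matrix.one_mul]
  rw [Matrix.mul_sub Ψ, Matrix.mul_sub (_ * (Ψ * Q)ᵀ), h, Matrix.mul_sub Q]
  abel

lemma inv_le_trace_regGramInv {ℓ k : ℕ} {ε : ℝ} (hε : 0 < ε) {G : Matrix (Fin ℓ) (Fin k) ℝ}
    (hdet : (Gᵀ * G).det = 0) : ε⁻¹ ≤ (regGramInv ε G).trace := by
  obtain ⟨v, hv0, hv⟩ := exists_mulVec_eq_zero_iff.mpr hdet
  have hSv : v = ε • (regGramInv ε G *ᵥ v) := by
    have h := congrArg (· *ᵥ v) (regGramInv_mul_gram hε G)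
    simp only [← mulVec_mulVec, hv, mulVec_zero, sub_mulVec, one_mulVec, smul_mulVec] at h
    exact sub_eq_zero.mp h.symm
  have hpos : 0 < ∑ i, v i ^ 2 := by
    obtain ⟨i, hi⟩ := Function.ne_iff.mp hv0
    exact Finset.sum_pos' (fun _ _ => sq_nonneg _) ⟨i, Finset.mem_univ i, by
      have : v i ≠ 0 := hi
      positivity⟩
  have hcs : ∑ i, v i ^ 2
      ≤ ε ^ 2 * ((regGramInv ε G)ᵀ * regGramInv ε G).trace * ∑ i, v i ^ 2 := by
    calc ∑ i, v i ^ 2 = ∑ i, ε ^ 2 * (∑ j, regGramInv ε G i j * v j) ^ 2 := by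
          refine Finset.sum_congr rfl fun i _ => ?_
          conv_lhs => rw [hSv]
          rw [Pi.smul_apply, smul_eq_mul, mul_pow]
          rfl
      _ ≤ ∑ i, ε ^ 2 * ((∑ j, regGramInv ε G i j ^ 2) * ∑ j, v j ^ 2) := by
          gcongr
          exact Finset.sum_mul_sq_le_sq_mul_sq _ _ _
      _ = _ := by
          rw [trace_transpose_mul_self_eq_sum, ← Finset.mul_sum, ← Finset.sum_mul, mul_assoc]
  have h1 : 1 ≤ ε ^ 2 * ((regGramInv ε G)ᵀ * regGramInv ε G).trace :=
    le_of_mul_le_mul_right (by rwa [one_mul]) hpos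
  rw [inv_le_iff_one_le_mul₀' hε, trace_regGramInv hε]
  nlinarith [mul_nonneg hε.le (trace_transpose_mul_self_nonneg (G * regGramInv ε G))]

/-- A tall Gaussian matrix has full column rank almost surely. -/
lemma ae_isUnit_det_gram {ℓ m k : ℕ} (hℓ : k + 1 < ℓ) {Q : Matrix (Fin m) (Fin k) ℝ}
    (hQ : Qᵀ * Q = 1) : ∀ᵐ M ∂gaussMatrix ℓ m, IsUnit ((M * Q)ᵀ * (M * Q)).det := by
  have hbound : ∀ ε : ℝ, 0 < ε →
      (gaussMatrix ℓ m).real {M | ((M * Q)ᵀ * (M * Q)).det = 0}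
        ≤ ε * (k / ((ℓ : ℝ) - k - 1)) := fun ε hε => by
    have h1 := mul_meas_ge_le_integral_of_nonneg
      (.of_forall fun M => trace_regGramInv_nonneg hε (M * Q))
      (integrable_trace_regGramInv (ℓ := ℓ) hε Q) ε⁻¹
    have h2 : (gaussMatrix ℓ m).real {M | ((M * Q)ᵀ * (M * Q)).det = 0}
        ≤ (gaussMatrix ℓ m).real {M | ε⁻¹ ≤ (regGramInv ε (M * Q)).trace} :=
      measureReal_mono fun M hM => inv_le_trace_regGramInv hε hM
    have h3 := h1.trans (integral_trace_regGramInv_le hℓ hε Q hQ)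
    rw [inv_mul_le_iff₀ hε] at h3
    exact h2.trans h3
  have hzero : (gaussMatrix ℓ m).real {M | ((M * Q)ᵀ * (M * Q)).det = 0} = 0 := by
    refine le_antisymm ?_ measureReal_nonneg
    have hlim : Filter.Tendsto (fun ε : ℝ => ε * (k / ((ℓ : ℝ) - k - 1)))
        (nhdsWithin 0 (Set.Ioi 0)) (nhds 0) := by
      have : Continuous fun ε : ℝ => ε * (k / ((ℓ : ℝ) - k - 1)) := by fun_prop
      simpa using (this.tendsto 0).mono_left nhdsWithin_le_nhds
    exact ge_of_tendsto hlim (Filter.eventually_of_mem self_mem_nhdsWithin hbound)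
  rw [measureReal_eq_zero_iff] at hzero
  refine (ae_iff.mpr ?_)
  simpa [isUnit_iff_ne_zero] using hzero

lemma tendsto_regGramInv {ℓ k : ℕ} {G : Matrix (Fin ℓ) (Fin k) ℝ} (hdet : IsUnit (Gᵀ * G).det) :
    Filter.Tendsto (fun ε => regGramInv ε G) (nhds 0) (nhds (Gᵀ * G)⁻¹) := by
  have hN : Continuous fun ε : ℝ => Gᵀ * G + ε • (1 : Matrix (Fin k) (Fin k) ℝ) := by fun_prop
  have h0 : Gᵀ * G + (0 : ℝ) • (1 : Matrix (Fin k) (Fin k) ℝ) = Gᵀ * G := by simp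
  have h1 := ((hN.matrix_det.tendsto 0).inv₀ (by rw [h0]; exact hdet.ne_zero)).smul
    (hN.matrix_adjugate.tendsto 0)
  simpa only [regGramInv, inv_def, Ring.inverse_eq_inv', h0] using h1

/-- Expected squared error of the sketched projection onto the range of a fixed orthonormal `Q`. -/
theorem lintegral_frobNorm_sub_sketch_sq_le {m n k ℓ : ℕ} (hℓ : k + 1 < ℓ)
    {Q : Matrix (Fin m) (Fin k) ℝ} (hQ : Qᵀ * Q = 1) (A : Matrix (Fin m) (Fin n) ℝ) :
    ∫⁻ Ψ, ENNReal.ofReal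
        (frobNorm (A - Q * (((Ψ * Q)ᵀ * (Ψ * Q))⁻¹ * (Ψ * Q)ᵀ * (Ψ * A))) ^ 2) ∂gaussMatrix ℓ m
      ≤ ENNReal.ofReal ((1 + k / ((ℓ : ℝ) - k - 1)) * frobNorm (A - Q * (Qᵀ * A)) ^ 2) := by
  set R := A - Q * (Qᵀ * A) with hRdef
  have hRQ : Rᵀ * Q = 0 := by
    rw [← transpose_transpose (Rᵀ * Q), transpose_mul, transpose_transpose,
      transpose_mul_sub_proj hQ, transpose_zero]
  let H : ℝ → Matrix (Fin ℓ) (Fin m) ℝ → Matrix (Fin k) (Fin n) ℝ := fun ε Ψ =>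
    (Ψ * Q * regGramInv ε (Ψ * Q))ᵀ * (Ψ * R)
  let ε : ℕ → ℝ := fun i => 1 / ((i : ℝ) + 1)
  have hε : ∀ i, 0 < ε i := fun i => by positivity
  have hbound : ∀ i, ∫⁻ Ψ, ENNReal.ofReal (frobNorm R ^ 2 + frobNorm (H (ε i) Ψ) ^ 2)
      ∂gaussMatrix ℓ m ≤ ENNReal.ofReal ((1 + k / ((ℓ : ℝ) - k - 1)) * frobNorm R ^ 2) := by
    intro i
    obtain ⟨hint, hle⟩ := integral_trace_sq_regGramInv_le hℓ (hε i) Q hQ R hRQ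
    simp only [← frobNorm_sq] at hint hle
    have hadd : Integrable (fun Ψ => frobNorm R ^ 2 + frobNorm (H (ε i) Ψ) ^ 2)
        (gaussMatrix ℓ m) := (integrable_const _).add hint
    rw [← ofReal_integral_eq_lintegral_ofReal hadd
      (.of_forall fun Ψ => add_nonneg (sq_nonneg _) (sq_nonneg _)),
      integral_add (integrable_const _) hint]
    refine ENNReal.ofReal_le_ofReal ?_
    simp only [integral_const, probReal_univ, one_smul]
    linarith
  have hcont : ∀ i, Continuous (H (ε i)) := fun i =>
    Continuous.matrix_mul (Continuous.matrix_transpose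
      (Continuous.matrix_mul (by fun_prop) (continuous_regGramInv_mul (hε i) Q))) (by fun_prop)
  calc _ ≤ ∫⁻ Ψ, Filter.liminf (fun i => ENNReal.ofReal
          (frobNorm R ^ 2 + frobNorm (H (ε i) Ψ) ^ 2)) Filter.atTop ∂gaussMatrix ℓ m := by
        refine lintegral_mono_ae ?_
        filter_upwards [ae_isUnit_det_gram hℓ hQ] with Ψ hΨ
        rw [frobNorm_sub_sketch_sq hQ A Ψ hΨ]
        have hS : Filter.Tendsto (fun i => regGramInv (ε i) (Ψ * Q)) Filter.atTop
            (nhds ((Ψ * Q)ᵀ * (Ψ * Q))⁻¹) :=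
          (tendsto_regGramInv hΨ).comp tendsto_one_div_add_atTop_nhds_zero_nat
        have hc : Continuous fun S : Matrix (Fin k) (Fin k) ℝ => ENNReal.ofReal
            (frobNorm R ^ 2 + frobNorm (S * (Ψ * Q)ᵀ * (Ψ * R)) ^ 2) :=
          ENNReal.continuous_ofReal.comp (continuous_const.add
            ((continuous_frobNorm.comp (by fun_prop)).pow 2))
        have hlim := (hc.tendsto _).comp hS
        refine le_of_eq (Eq.trans ?_ hlim.liminf_eq.symm |>.trans ?_)
        · rfl
        · congr 1
          ext i
          simp only [H, Function.comp, transpose_mul, transpose_regGramInv]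
    _ ≤ Filter.liminf (fun i => ∫⁻ Ψ, ENNReal.ofReal
          (frobNorm R ^ 2 + frobNorm (H (ε i) Ψ) ^ 2) ∂gaussMatrix ℓ m) Filter.atTop :=
        lintegral_liminf_le fun i => (((continuous_frobNorm.comp (hcont i)).measurable.pow_const
          2).const_add _).ennreal_ofReal
    _ ≤ _ := Filter.liminf_le_of_le (by isBoundedDefault) fun b hb => by
        obtain ⟨i, hi⟩ := hb.exists
        exact hi.trans (hbound i)

lemma exists_orthonormal_factorization {m n : ℕ} (C : Matrix (Fin m) (Fin n) ℝ) :
    ∃ (V : Matrix (Fin m) (Fin C.rank) ℝ) (Y : Matrix (Fin C.rank) (Fin n) ℝ),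
      Vᵀ * V = 1 ∧ C = V * Y := by
  let c : Fin n → EuclideanSpace ℝ (Fin m) := fun j => WithLp.toLp 2 (C.col j)
  let U : Submodule ℝ (EuclideanSpace ℝ (Fin m)) := Submodule.span ℝ (Set.range c)
  have hU : Module.finrank ℝ U = C.rank := by
    rw [rank_eq_finrank_span_cols]
    have : U = (Submodule.span ℝ (Set.range C.col)).map
        ((WithLp.linearEquiv 2 ℝ (Fin m → ℝ)).symm : (Fin m → ℝ) →ₗ[ℝ] _) := by
      rw [Submodule.map_span, ← Set.range_comp]
      rfl
    rw [this, LinearEquiv.finrank_map_eq]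
  let b : OrthonormalBasis (Fin C.rank) ℝ U := (stdOrthonormalBasis ℝ U).reindex (finCongr hU)
  refine ⟨of fun i a => (b a : EuclideanSpace ℝ (Fin m)) i,
    of fun a j => inner ℝ (b a : EuclideanSpace ℝ (Fin m)) (c j), ?_, ?_⟩
  · ext a a'
    have h := orthonormal_iff_ite.mp b.orthonormal a a'
    rw [Submodule.coe_inner, PiLp.inner_apply] at h
    simp only [mul_apply, transpose_apply, of_apply, one_apply, ← h]
    exact Finset.sum_congr rfl fun i _ => by simp [mul_comm]
  · ext i j
    have hc : c j ∈ U := Submodule.subset_span ⟨j, rfl⟩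
    have h := congrArg (fun x : U => (x : EuclideanSpace ℝ (Fin m)) i)
      (b.sum_repr' ⟨c j, hc⟩)
    have h' : C i j = (c j) i := rfl
    rw [h']
    simp only [mul_apply, of_apply]
    rw [← h]
    simp [Submodule.coe_inner, mul_comm]

lemma measurable_matrix_mul {α : Type*} [MeasurableSpace α] {a b c : ℕ}
    {f : α → Matrix (Fin a) (Fin b) ℝ} {g : α → Matrix (Fin b) (Fin c) ℝ}
    (hf : Measurable f) (hg : Measurable g) : Measurable fun x => f x * g x := by
  refine measurable_pi_iff.mpr fun i => measurable_pi_iff.mpr fun j => ?_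
  simp only [mul_apply]
  exact Finset.measurable_sum _ fun y _ =>
    (measurable_pi_iff.mp (measurable_pi_iff.mp hf i) y).mul
      (measurable_pi_iff.mp (measurable_pi_iff.mp hg y) j)

lemma measurable_matrix_inv {a : ℕ} :
    Measurable (fun M : Matrix (Fin a) (Fin a) ℝ => M⁻¹) := by
  refine measurable_pi_iff.mpr fun i => measurable_pi_iff.mpr fun j => ?_
  simp only [inv_def, Ring.inverse_eq_inv', Matrix.smul_apply, smul_eq_mul]
  exact (Continuous.matrix_det continuous_id).measurable.inv.mul
    ((Continuous.matrix_adjugate continuous_id).matrix_elem i j).measurable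

lemma measurable_sketch_error {α : Type*} [MeasurableSpace α] {m n k ℓ : ℕ}
    {Q : α → Matrix (Fin m) (Fin k) ℝ} {Ψ : α → Matrix (Fin ℓ) (Fin m) ℝ}
    (hQ : Measurable Q) (hΨ : Measurable Ψ) (A : Matrix (Fin m) (Fin n) ℝ) :
    Measurable fun x => frobNorm (A - Q x *
      (((Ψ x * Q x)ᵀ * (Ψ x * Q x))⁻¹ * (Ψ x * Q x)ᵀ * (Ψ x * A))) := by
  have hG := measurable_matrix_mul hΨ hQ
  have hGt := measurable_transpose_matrix.comp hG
  have hc : Continuous fun M : Matrix (Fin m) (Fin n) ℝ => frobNorm (A - M) :=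
    continuous_frobNorm.comp (by fun_prop)
  exact hc.measurable.comp (measurable_matrix_mul hQ (measurable_matrix_mul (measurable_matrix_mul
    (measurable_matrix_inv.comp (measurable_matrix_mul hGt hG)) hGt)
    (measurable_matrix_mul hΨ measurable_const)))

lemma tailEnergy_set_nonempty {m n : ℕ} (A : Matrix (Fin m) (Fin n) ℝ) (j : ℕ) :
    {x : ℝ | ∃ B : Matrix (Fin m) (Fin n) ℝ, B.rank < j + 1 ∧ x = frobNorm (A - B) ^ 2}.Nonempty :=
  ⟨_, 0, by simp, rfl⟩

lemma le_tailEnergy_sq {m n : ℕ} {A : Matrix (Fin m) (Fin n) ℝ} {j : ℕ} {x : ℝ}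
    (h : ∀ C : Matrix (Fin m) (Fin n) ℝ, C.rank ≤ j → x ≤ frobNorm (A - C) ^ 2) :
    x ≤ tailEnergy A (j + 1) ^ 2 := by
  rw [tailEnergy, Real.sq_sqrt]
  · refine le_csInf (tailEnergy_set_nonempty A j) ?_
    rintro _ ⟨C, hC, rfl⟩
    exact h C (Nat.lt_succ_iff.mp hC)
  · refine Real.sInf_nonneg ?_
    rintro _ ⟨C, -, rfl⟩
    exact sq_nonneg _

lemma le_tailEnergy {m n : ℕ} {A : Matrix (Fin m) (Fin n) ℝ} {j : ℕ} {x : ℝ}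
    (h : ∀ C : Matrix (Fin m) (Fin n) ℝ, C.rank ≤ j → x ≤ frobNorm (A - C)) :
    x ≤ tailEnergy A (j + 1) := by
  rcases le_or_gt x 0 with hx | hx
  · exact hx.trans (Real.sqrt_nonneg _)
  · exact (pow_le_pow_iff_left₀ hx.le (Real.sqrt_nonneg _) two_ne_zero).mp
      (le_tailEnergy_sq fun C hC => pow_le_pow_left₀ hx.le (h C hC) 2)

lemma one_add_div_sub_pos {a b : ℕ} (h : a + 1 < b) :
    (0 : ℝ) < 1 + a / ((b : ℝ) - a - 1) := by
  have h2 : ((a + 1 : ℕ) : ℝ) < b := by exact_mod_cast h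
  push_cast at h2
  exact add_pos_of_pos_of_nonneg one_pos (div_nonneg (by positivity) (by linarith))

/-- Expected squared error of the randomized range finder, compared with a fixed matrix of low
rank. -/
lemma lintegral_frobNorm_sub_proj_sq_le {m n k ϱ : ℕ} (hϱ : ϱ + 1 < k)
    (A : Matrix (Fin m) (Fin n) ℝ) {Q : Matrix (Fin n) (Fin k) ℝ → Matrix (Fin m) (Fin k) ℝ}
    (hQorth : ∀ Ω, (Q Ω)ᵀ * Q Ω = 1)
    (hQrange : ∀ Ω, ∃ M : Matrix (Fin k) (Fin k) ℝ, A * Ω = Q Ω * M)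
    (C : Matrix (Fin m) (Fin n) ℝ) (hC : C.rank ≤ ϱ) :
    ∫⁻ Ω, ENNReal.ofReal (frobNorm (A - Q Ω * ((Q Ω)ᵀ * A)) ^ 2) ∂gaussMatrix n k
      ≤ ENNReal.ofReal ((1 + ϱ / ((k : ℝ) - ϱ - 1)) * frobNorm (A - C) ^ 2) := by
  obtain ⟨V, Y, hV, hCV⟩ := exists_orthonormal_factorization Cᵀ
  rw [← rank_transpose C] at hC
  have hdk : Cᵀ.rank + 1 < k := by omega
  let F : Matrix (Fin k) (Fin n) ℝ → ℝ := fun Ψ =>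
    frobNorm (Aᵀ - V * (((Ψ * V)ᵀ * (Ψ * V))⁻¹ * (Ψ * V)ᵀ * (Ψ * Aᵀ)))
  have hF : Measurable F := measurable_sketch_error measurable_const measurable_id Aᵀ
  have hpt : ∀ Ω, frobNorm (A - Q Ω * ((Q Ω)ᵀ * A)) ^ 2 ≤ F Ωᵀ ^ 2 := fun Ω => by
    obtain ⟨M, hM⟩ := hQrange Ω
    let W := ((Ωᵀ * V)ᵀ * (Ωᵀ * V))⁻¹ * (Ωᵀ * V)ᵀ
    have h : frobNorm (A - Q Ω * (M * (V * W)ᵀ)) = F Ωᵀ := by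
      rw [← frobNorm_transpose, ← Matrix.mul_assoc, ← hM]
      simp only [F]
      congr 1
      rw [transpose_sub, transpose_mul, transpose_transpose, transpose_mul A]
      simp only [W, Matrix.mul_assoc]
    rw [← h]
    exact frobNorm_sub_proj_sq_le (hQorth Ω) A _
  have hfac : (1 : ℝ) + Cᵀ.rank / ((k : ℝ) - Cᵀ.rank - 1) ≤ 1 + ϱ / ((k : ℝ) - ϱ - 1) := by
    have h1 : (Cᵀ.rank : ℝ) ≤ ϱ := by exact_mod_cast hC
    have h2 : ((ϱ + 1 : ℕ) : ℝ) < k := by exact_mod_cast hϱ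
    push_cast at h2
    gcongr
    linarith
  calc _ ≤ ∫⁻ Ω : Matrix (Fin n) (Fin k) ℝ, ENNReal.ofReal (F Ωᵀ ^ 2) ∂gaussMatrix n k :=
        lintegral_mono fun Ω => ENNReal.ofReal_le_ofReal (hpt Ω)
    _ = ∫⁻ Ψ, ENNReal.ofReal (F Ψ ^ 2) ∂gaussMatrix k n := by
        rw [← map_transpose_gaussMatrix n k,
          lintegral_map (hF.pow_const 2).ennreal_ofReal measurable_transpose_matrix]
    _ ≤ _ := lintegral_frobNorm_sub_sketch_sq_le hdk hV Aᵀ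
    _ ≤ _ := by
        refine ENNReal.ofReal_le_ofReal (mul_le_mul hfac ?_ (sq_nonneg _)
          (one_add_div_sub_pos hϱ).le)
        rw [← frobNorm_transpose (A - C), transpose_sub]
        conv_rhs => rw [hCV]
        exact frobNorm_sub_proj_sq_le hV Aᵀ Y

/-- Expected squared error of the randomized range finder. -/
theorem lintegral_frobNorm_sub_proj_sq_le_tailEnergy {m n k ϱ : ℕ} (hϱ : ϱ + 1 < k)
    (A : Matrix (Fin m) (Fin n) ℝ) {Q : Matrix (Fin n) (Fin k) ℝ → Matrix (Fin m) (Fin k) ℝ}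
    (hQorth : ∀ Ω, (Q Ω)ᵀ * Q Ω = 1)
    (hQrange : ∀ Ω, ∃ M : Matrix (Fin k) (Fin k) ℝ, A * Ω = Q Ω * M) :
    ∫⁻ Ω, ENNReal.ofReal (frobNorm (A - Q Ω * ((Q Ω)ᵀ * A)) ^ 2) ∂gaussMatrix n k
      ≤ ENNReal.ofReal ((1 + ϱ / ((k : ℝ) - ϱ - 1)) * tailEnergy A (ϱ + 1) ^ 2) := by
  have hle := lintegral_frobNorm_sub_proj_sq_le hϱ A hQorth hQrange
  have hfin := ((hle 0 (by simp)).trans_lt ENNReal.ofReal_lt_top).ne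
  have hk := one_add_div_sub_pos hϱ
  rw [← ENNReal.ofReal_toReal hfin]
  refine ENNReal.ofReal_le_ofReal ?_
  rw [← div_le_iff₀' hk]
  refine le_tailEnergy_sq fun C hC => ?_
  rw [div_le_iff₀' hk]
  exact ENNReal.toReal_le_of_le_ofReal (mul_nonneg hk.le (sq_nonneg _)) (hle C hC)

lemma integral_le_sqrt_of_lintegral_sq_le {α : Type*} [MeasurableSpace α] {μ : Measure α}
    [IsProbabilityMeasure μ] {g : α → ℝ} (hg : Measurable g) {D : ℝ} (hD : 0 ≤ D)
    (h : ∫⁻ x, ENNReal.ofReal (g x ^ 2) ∂μ ≤ ENNReal.ofReal D) :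
    Integrable g μ ∧ ∫ x, g x ∂μ ≤ √D := by
  have hint : Integrable (fun x => g x ^ 2) μ := ⟨(hg.pow_const 2).aestronglyMeasurable, by
    rw [hasFiniteIntegral_iff_ofReal (.of_forall fun x => sq_nonneg _)]
    exact h.trans_lt ENNReal.ofReal_lt_top⟩
  have hL2 : MemLp g 2 μ := (memLp_two_iff_integrable_sq hg.aestronglyMeasurable).mpr hint
  refine ⟨hL2.integrable (by norm_num), Real.le_sqrt_of_sq_le ?_⟩
  have hvar := variance_nonneg g μ
  rw [variance_eq_sub hL2] at hvar
  have hle : ∫ x, g x ^ 2 ∂μ ≤ D := by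
    rw [integral_eq_lintegral_of_nonneg_ae (.of_forall fun x => sq_nonneg _)
      (hg.pow_const 2).aestronglyMeasurable]
    exact ENNReal.toReal_le_of_le_ofReal hD h
  simp only [Pi.pow_apply] at hvar
  linarith

/-- A best low-rank approximation of `Y` is a quasi-optimal low-rank approximation of any nearby
matrix `A`. -/
lemma frobNorm_sub_le_tailEnergy_add {m n r : ℕ} (A : Matrix (Fin m) (Fin n) ℝ)
    {Y B : Matrix (Fin m) (Fin n) ℝ}
    (hB : ∀ C : Matrix (Fin m) (Fin n) ℝ, C.rank ≤ r → frobNorm (Y - B) ≤ frobNorm (Y - C)) :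
    frobNorm (A - B) ≤ tailEnergy A (r + 1) + 2 * frobNorm (A - Y) := by
  rw [← sub_le_iff_le_add]
  refine le_tailEnergy fun C hC => ?_
  have h1 := frobNorm_add_le (A - Y) (Y - B)
  have h2 := frobNorm_add_le (Y - A) (A - C)
  rw [sub_add_sub_cancel] at h1 h2
  rw [frobNorm_sub_comm Y A] at h2
  linarith [hB C hC]

/-- **Corollary 6.3 (fixed-rank approximation Frobenius-norm error), real case.**
Sketch with independent standard normal `Ω ∈ ℝ^{n×k}`, `Ψ ∈ ℝ^{ℓ×m}`, where
`r + 1 < k ≤ min(m,n)`, `ℓ ≤ m`, `ℓ > k + 1`.  Let `Q(Ω)` be a measurable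
orthonormal-range factor whose column space contains that of `AΩ`, set
`X = (ΨQ)† Ψ A`, and let `B(Ω,Ψ)` be a measurable best rank-`r` Frobenius-norm
approximation of `Q X`.  Then for every `ϱ < k - 1`:
`E ‖A - B‖_F ≤ τ_{r+1}(A) + 2 √(1 + k/(ℓ-k-1)) √(1 + ϱ/(k-ϱ-1)) τ_{ϱ+1}(A)`. -/
theorem sketched_fixed_rank_approx_error {m n k ℓ r : ℕ}
    (hrk : r + 1 < k) (hkm : k ≤ m) (hkn : k ≤ n) (hℓm : ℓ ≤ m) (hℓ : k + 1 < ℓ)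
    (A : Matrix (Fin m) (Fin n) ℝ)
    (Q : Matrix (Fin n) (Fin k) ℝ → Matrix (Fin m) (Fin k) ℝ)
    (hQmeas : Measurable Q)
    (hQorth : ∀ Ω, (Q Ω)ᵀ * Q Ω = 1)
    (hQrange : ∀ Ω, ∃ M : Matrix (Fin k) (Fin k) ℝ, A * Ω = Q Ω * M)
    (X : Matrix (Fin n) (Fin k) ℝ → Matrix (Fin ℓ) (Fin m) ℝ
      → Matrix (Fin k) (Fin n) ℝ)
    (hX : ∀ Ω Ψ, X Ω Ψ
      = ((Ψ * Q Ω)ᵀ * (Ψ * Q Ω))⁻¹ * (Ψ * Q Ω)ᵀ * (Ψ * A))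
    (B : Matrix (Fin n) (Fin k) ℝ × Matrix (Fin ℓ) (Fin m) ℝ
      → Matrix (Fin m) (Fin n) ℝ)
    (hBmeas : Measurable B)
    (hBrank : ∀ p, (B p).rank ≤ r)
    (hBbest : ∀ p, ∀ C : Matrix (Fin m) (Fin n) ℝ, C.rank ≤ r →
      frobNorm (Q p.1 * X p.1 p.2 - B p) ≤ frobNorm (Q p.1 * X p.1 p.2 - C))
    (ϱ : ℕ) (hϱ : ϱ + 1 < k) :
    ∫ p, frobNorm (A - B p) ∂((gaussMatrix n k).prod (gaussMatrix ℓ m))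
      ≤ tailEnergy A (r + 1)
        + 2 * Real.sqrt (1 + (k : ℝ) / ((ℓ : ℝ) - k - 1))
          * Real.sqrt (1 + (ϱ : ℝ) / ((k : ℝ) - ϱ - 1)) * tailEnergy A (ϱ + 1) := by
  have hkpos := (one_add_div_sub_pos hℓ).le
  have hϱpos := (one_add_div_sub_pos hϱ).le
  let g : Matrix (Fin n) (Fin k) ℝ × Matrix (Fin ℓ) (Fin m) ℝ → ℝ := fun p =>
    frobNorm (A - Q p.1 * X p.1 p.2)
  have hg : Measurable g := by
    simp only [g, hX]
    exact measurable_sketch_error (hQmeas.comp measurable_fst) measurable_snd A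
  have hg2 : ∫⁻ p, ENNReal.ofReal (g p ^ 2) ∂((gaussMatrix n k).prod (gaussMatrix ℓ m))
      ≤ ENNReal.ofReal ((1 + (k : ℝ) / ((ℓ : ℝ) - k - 1)) *
        ((1 + (ϱ : ℝ) / ((k : ℝ) - ϱ - 1)) * tailEnergy A (ϱ + 1) ^ 2)) := by
    calc _ ≤ ∫⁻ Ω, ∫⁻ Ψ, ENNReal.ofReal (g (Ω, Ψ) ^ 2) ∂gaussMatrix ℓ m ∂gaussMatrix n k :=
          lintegral_prod_le _
      _ ≤ ∫⁻ Ω, ENNReal.ofReal (1 + (k : ℝ) / ((ℓ : ℝ) - k - 1)) *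
            ENNReal.ofReal (frobNorm (A - Q Ω * ((Q Ω)ᵀ * A)) ^ 2) ∂gaussMatrix n k := by
          refine lintegral_mono fun Ω => ?_
          simp only [g, hX]
          rw [← ENNReal.ofReal_mul hkpos]
          exact lintegral_frobNorm_sub_sketch_sq_le hℓ (hQorth Ω) A
      _ ≤ _ := by
          rw [lintegral_const_mul' _ _ ENNReal.ofReal_ne_top, ENNReal.ofReal_mul hkpos]
          gcongr
          exact lintegral_frobNorm_sub_proj_sq_le_tailEnergy hϱ A hQorth hQrange
  obtain ⟨hgint, hgle⟩ := integral_le_sqrt_of_lintegral_sq_le hg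
    (mul_nonneg hkpos (mul_nonneg hϱpos (sq_nonneg _))) hg2
  rw [Real.sqrt_mul hkpos, Real.sqrt_mul hϱpos,
    Real.sqrt_sq (show 0 ≤ tailEnergy A (ϱ + 1) from Real.sqrt_nonneg _)] at hgle
  calc _ ≤ ∫ p, (tailEnergy A (r + 1) + 2 * g p) ∂((gaussMatrix n k).prod (gaussMatrix ℓ m)) :=
        integral_mono_of_nonneg (.of_forall fun p => frobNorm_nonneg _)
          ((integrable_const _).add (hgint.const_mul 2))
          (.of_forall fun p => frobNorm_sub_le_tailEnergy_add A (hBbest p))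
    _ = tailEnergy A (r + 1) + 2 * ∫ p, g p ∂((gaussMatrix n k).prod (gaussMatrix ℓ m)) := by
        rw [integral_add (integrable_const _) (hgint.const_mul 2), integral_const_mul]
        simp
    _ ≤ _ := by linarith
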